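/- Let f ∈ WRP with sign ε and dual g. For β ∈ F_q^* define N_{sq,β} = #{x ∈ F_q : f(x) ∈ SQ and Tr(βx) = 0} and N_{nsq,β} = #{x ∈ F_q : f(x) ∈ NSQ and Tr(βx) = 0}. Then: (i) for β ∈ F_q^* \ Supp(W_f): if n+s is even, N_{sq,β} = N_{nsq,β} = ((p−1)/2)(p^{n−2} − ε√(p*)^{n+s−4}); if n+s is odd, N_{sq,β} = ((p−1)/2)(p^{n−2} + ε η_0(−1)√(p*)^{n+s−3}) and N_{nsq,β} = ((p−1)/2)(p^{n−2} − ε η_0(−1)√(p*)^{n+s−3}). (ii) For nonzero β ∈ Supp(W_f) with n+s even: N_{sq,β} = ((p−1)/2)(p^{n−2} − ε η_0(−1)√(p*)^{n+s−2}) if g(β) = 0 or g(β) ∈ NSQ, and = ((p−1)/2)(p^{n−2} + ε η_0(−1)√(p*)^{n+s−2}) if g(β) ∈ SQ; N_{nsq,β} = ((p−1)/2)(p^{n−2} − ε η_0(−1)√(p*)^{n+s−2}) if g(β) = 0 or g(β) ∈ SQ, and = ((p−1)/2)(p^{n−2} + ε η_0(−1)√(p*)^{n+s−2}) if g(β) ∈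 NSQ. (iii) For nonzero β ∈ Supp(W_f) with n+s odd: N_{sq,β} = ((p−1)/2)(p^{n−2} + ε√(p*)^{n+s−1}) if g(β) = 0, = ((p−1)/2)(p^{n−2} − ε√(p*)^{n+s−3}) if g(β) ∈ SQ, = ((p−1)/2)(p^{n−2} + ε√(p*)^{n+s−3}) if g(β) ∈ NSQ; N_{nsq,β} = ((p−1)/2)(p^{n−2} − ε√(p*)^{n+s−1}) if g(β) = 0, = ((p−1)/2)(p^{n−2} − ε√(p*)^{n+s−3}) if g(β) ∈ SQ, = ((p−1)/2)(p^{n−2} + ε√(p*)^{n+s−3}) if g(β) ∈ NSQ. -/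

import Mathlib

open scoped BigOperators Classical

noncomputable section

/-- `ξ_p^j` for `j : ZMod p`, where `ξ_p = exp(2πi/p)` and the exponent `j`
is lifted to a natural number. -/
def ep (p : ℕ) (j : ZMod p) : ℂ :=
  Complex.exp (2 * Real.pi * Complex.I * (j.val : ℂ) / (p : ℂ))

/-- `√(p*)`: equal to `√p` if `p ≡ 1 (mod 4)` and to `i√p` if `p ≡ 3 (mod 4)`. -/
def sqrtPStar (p : ℕ) : ℂ :=
  if p % 4 = 1 then ((Real.sqrt p : ℝ) : ℂ) else Complex.I * ((Real.sqrt p : ℝ) : ℂ)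

/-- The quadratic character `η₀` of `F_p` (extended by `η₀(0) = 0`), with values in `ℂ`. -/
def eta0 (p : ℕ) [Fact p.Prime] (j : ZMod p) : ℂ :=
  ((quadraticChar (ZMod p) j : ℤ) : ℂ)

/-- The Walsh transform of `f : F_q → F_p`. -/
def walsh (p : ℕ) {F : Type*} [Field F] [Fintype F] [Algebra (ZMod p) F]
    (f : F → ZMod p) (β : F) : ℂ :=
  ∑ x : F, ep p (f x - Algebra.trace (ZMod p) F (β * x))

/-- `f` is weakly regular `s`-plateaued with sign `ε` and dual `g`:
`W_f(β) = ε √(p*)^{n+s} ξ_p^{g(β)}` on the Walsh support, `W_f(β) = 0` off it,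
and `g` vanishes off the Walsh support. -/
def IsWeaklyRegularPlateaued (p n s : ℕ) {F : Type*} [Field F] [Fintype F]
    [Algebra (ZMod p) F] (f : F → ZMod p) (ε : ℂ) (g : F → ZMod p) : Prop :=
  (ε = 1 ∨ ε = -1) ∧
  (∀ β : F, walsh p f β ≠ 0 →
      walsh p f β = ε * sqrtPStar p ^ (n + s) * ep p (g β)) ∧
  (∀ β : F, walsh p f β = 0 → g β = 0)

/-- `f` lies in the class `WRP`: weakly regular `s`-plateaued with sign `ε` and dual `g`,
unbalanced, `f(0) = 0`, and `f(ax) = a^h f(x)` for some positive even `h` with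
`gcd(h-1, p-1) = 1`. -/
def IsWRP (p n s : ℕ) {F : Type*} [Field F] [Fintype F]
    [Algebra (ZMod p) F] (f : F → ZMod p) (ε : ℂ) (g : F → ZMod p) : Prop :=
  IsWeaklyRegularPlateaued p n s f ε g ∧
  walsh p f 0 ≠ 0 ∧
  f 0 = 0 ∧
  ∃ h : ℕ, 0 < h ∧ Even h ∧ Nat.gcd (h - 1) (p - 1) = 1 ∧
    ∀ (a : (ZMod p)ˣ) (x : F),
      f (algebraMap (ZMod p) F (a : ZMod p) * x) = (a : ZMod p) ^ h * f x


section Gauss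

open Polynomial

theorem ep_eq_stdAddChar (p : ℕ) [NeZero p] (j : ZMod p) : ep p j = ZMod.stdAddChar j := by
  rw [ZMod.stdAddChar_apply, ZMod.toCircle_apply, ep]

theorem ep_eq_pow (p : ℕ) (j : ZMod p) :
    ep p j = Complex.exp (2 * Real.pi * Complex.I / p) ^ j.val := by
  rw [ep, ← Complex.exp_nat_mul]
  congr 1
  ring

theorem sum_zmod_val {p : ℕ} [NeZero p] {M : Type*} [AddCommMonoid M] (f : ℕ → M) :
    ∑ j : ZMod p, f j.val = ∑ i ∈ Finset.range p, f i := by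
  refine Finset.sum_nbij' (fun j => j.val) (fun i => (i : ZMod p)) ?_ ?_ ?_ ?_ ?_
  · intro j _; simpa using ZMod.val_lt j
  · intro i _; simp
  · intro j _; simp
  · intro i hi; exact ZMod.val_cast_of_lt (by simpa using hi)
  · intro j _; rfl

theorem cyclotomic_dvd_of_aeval_eq_zero {p : ℕ} (hp : 0 < p) {Q : ℤ[X]}
    (h : aeval (Complex.exp (2 * Real.pi * Complex.I / p)) Q = 0) : cyclotomic p ℤ ∣ Q := by
  have hξ := Complex.isPrimitiveRoot_exp p hp.ne'
  rw [cyclotomic_eq_minpoly hξ hp]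
  exact minpoly.isIntegrallyClosed_dvd (hξ.isIntegral hp) h

/-- The Euler operator `X * d/dX`. -/
def eulerOp (K : Type*) [CommRing K] : Module.End K K[X] :=
  LinearMap.mulLeft K X ∘ₗ derivative

theorem eulerOp_apply {K : Type*} [CommRing K] (f : K[X]) :
    eulerOp K f = X * derivative f := rfl

theorem eulerOp_pow_X_pow {K : Type*} [CommRing K] (k j : ℕ) :
    (eulerOp K ^ k) (X ^ j) = C ((j : K) ^ k) * X ^ j := by
  induction k with
  | zero => simp
  | succ k ih =>
    rw [pow_succ', Module.End.mul_apply, ih, eulerOp_apply, derivative_C_mul_X_pow]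
    rcases j with _ | j
    · simp
    · simp only [Nat.add_sub_cancel, map_mul, map_pow]
      ring

theorem eulerOp_pow_X_sub_one_pow {K : Type*} [CommRing K] (k a : ℕ) (u : K[X]) :
    ∃ v : K[X], (eulerOp K ^ k) ((X - 1) ^ (a + k) * u) = (X - 1) ^ a * v ∧
      v.eval 1 = ((a + k).descFactorial k : K) * u.eval 1 := by
  induction k generalizing u with
  | zero => exact ⟨u, by simp⟩
  | succ k ih =>
    obtain ⟨v, hv, hv1⟩ := ih (C ((a + k + 1 : ℕ) : K) * X * u + (X - 1) * X * derivative u)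
    refine ⟨v, ?_, ?_⟩
    · rw [pow_succ, Module.End.mul_apply, ← hv, eulerOp_apply]
      congr 1
      rw [← add_assoc, derivative_mul, derivative_pow]
      simp
      ring
    · rw [hv1, ← add_assoc, Nat.succ_descFactorial_succ]
      simp
      ring

theorem prod_X_pow_sub_one {K : Type*} [CommRing K] (m : ℕ) (e : ℕ → ℕ) :
    ∃ w : K[X], ∏ r ∈ Finset.range m, (X ^ e r * (X ^ (r + 1) - 1)) = (X - 1) ^ m * w ∧
      w.eval 1 = (m.factorial : K) := by
  refine ⟨∏ r ∈ Finset.range m, (X ^ e r * ∑ i ∈ Finset.range (r + 1), X ^ i), ?_, ?_⟩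
  · have : ((X : K[X]) - 1) ^ m = ∏ _r ∈ Finset.range m, ((X : K[X]) - 1) := by simp
    rw [this, ← Finset.prod_mul_distrib]
    refine Finset.prod_congr rfl fun r _ => ?_
    rw [← geom_sum_mul]
    ring
  · rw [eval_prod, ← Finset.prod_range_add_one_eq_factorial]
    push_cast
    refine Finset.prod_congr rfl fun r _ => ?_
    simp [eval_finsetSum]

theorem descFactorial_two_mul_eq {p m : ℕ} (hpm : p = 2 * m + 1) :
    ((m + m).descFactorial m : ZMod p) = (-1) ^ m * (m.factorial : ZMod p) := by
  have h0 : (2 * m + 1 : ZMod p) = 0 := by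
    have : ((2 * m + 1 : ℕ) : ZMod p) = 0 := by rw [← hpm]; simp
    simpa using this
  have : ∀ k ≤ m, ((m + m).descFactorial k : ZMod p) = (-1) ^ k * (k.factorial : ZMod p) := by
    intro k
    induction k with
    | zero => simp
    | succ k ih =>
      intro hk
      rw [Nat.descFactorial_succ, Nat.cast_mul, ih (by omega), Nat.factorial_succ,
        Nat.cast_sub (by omega), pow_succ]
      push_cast
      linear_combination (-1) ^ k * (k.factorial : ZMod p) * h0
  exact this m le_rfl

theorem geom_sum_eq_X_sub_one_pow (p : ℕ) [Fact p.Prime] :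
    ∑ i ∈ Finset.range p, (X : (ZMod p)[X]) ^ i = (X - 1) ^ (p - 1) := by
  have hne : (X : (ZMod p)[X]) - 1 ≠ 0 := X_sub_C_ne_zero 1
  apply mul_right_cancel₀ hne
  have hp := (Fact.out : p.Prime).pos
  rw [geom_sum_mul, ← pow_succ, Nat.sub_add_cancel hp, sub_pow_char, one_pow]

/-- The sign in the comparison of the Gauss sum with the product `∏ ζ^{(r+1)m} (ζ^{r+1} - 1)`. -/
theorem eq_neg_one_pow_of_sum_eq_prod {p m : ℕ} [Fact p.Prime] (hpm : p = 2 * m + 1) (δ : ℤ)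
    (hδ : δ = 1 ∨ δ = -1)
    (h : ∑ j : ZMod p, (quadraticChar (ZMod p) j : ℂ)
          * Complex.exp (2 * Real.pi * Complex.I / p) ^ j.val
        = δ * ∏ r ∈ Finset.range m, (Complex.exp (2 * Real.pi * Complex.I / p) ^ ((r + 1) * m)
            * (Complex.exp (2 * Real.pi * Complex.I / p) ^ (r + 1) - 1))) :
    δ = (-1) ^ m := by
  have hp : p.Prime := Fact.out
  have hm : 0 < m := by
    have := hp.two_le
    omega
  have hdvd := cyclotomic_dvd_of_aeval_eq_zero (p := p) hp.pos
    (Q := ∑ j : ZMod p, C (quadraticChar (ZMod p) j) * X ^ j.val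
      - C δ * ∏ r ∈ Finset.range m, (X ^ ((r + 1) * m) * (X ^ (r + 1) - 1)))
    (by simp only [map_sub, map_sum, map_prod, map_mul, map_pow, aeval_X, map_one, eq_intCast,
        map_intCast]; exact sub_eq_zero.mpr h)
  have hdvd' := Polynomial.map_dvd (Int.castRingHom (ZMod p)) hdvd
  rw [cyclotomic_prime] at hdvd'
  simp only [Polynomial.map_sum, Polynomial.map_pow, map_X, Polynomial.map_sub,
    Polynomial.map_mul, map_C, Polynomial.map_prod, Polynomial.map_one] at hdvd'
  rw [geom_sum_eq_X_sub_one_pow] at hdvd'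
  obtain ⟨w, hw, hw1⟩ := prod_X_pow_sub_one (K := ZMod p) m (fun r => (r + 1) * m)
  obtain ⟨v, hv, hv1⟩ := eulerOp_pow_X_sub_one_pow (K := ZMod p) m m 1
  have hsum : ∑ j : ZMod p, C ((Int.castRingHom (ZMod p)) (quadraticChar (ZMod p) j)) * X ^ j.val
      = (X - 1) ^ m * v := by
    rw [← hv, mul_one, show m + m = p - 1 by omega, ← geom_sum_eq_X_sub_one_pow, ← sum_zmod_val,
      map_sum]
    refine Finset.sum_congr rfl fun j _ => ?_
    rw [eulerOp_pow_X_pow, ZMod.natCast_zmod_val]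
    congr 2
    have h2 : ringChar (ZMod p) ≠ 2 := by
      rw [ZMod.ringChar_zmod_n]
      omega
    have := quadraticChar_eq_pow_of_char_ne_two' h2 j
    rw [ZMod.card, show p / 2 = m by omega] at this
    simpa using this
  rw [hsum, hw, show p - 1 = m + m by omega, pow_add] at hdvd'
  have hne : (X : (ZMod p)[X]) - 1 ≠ 0 := X_sub_C_ne_zero 1
  rw [show (X - 1) ^ m * v - C ((Int.castRingHom (ZMod p)) δ) * ((X - 1) ^ m * w)
    = (X - 1) ^ m * (v - C ((Int.castRingHom (ZMod p)) δ) * w) by ring] at hdvd'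
  have h3 := dvd_trans (dvd_pow_self _ hm.ne')
    ((mul_dvd_mul_iff_left (pow_ne_zero m hne)).mp hdvd')
  rw [← C_1, dvd_iff_isRoot, IsRoot.def] at h3
  simp only [eval_sub, eval_mul, eval_C, hv1, hw1, eval_one, mul_one,
    descFactorial_two_mul_eq hpm, ← sub_mul, mul_eq_zero] at h3
  have hfac : (m.factorial : ZMod p) ≠ 0 := by
    rw [Ne, ZMod.natCast_eq_zero_iff, hp.dvd_factorial]
    omega
  have h4 := h3.resolve_right hfac
  have h5 : (((-1) ^ m - δ : ℤ) : ZMod p) = 0 := by simpa using h4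
  rw [ZMod.intCast_zmod_eq_zero_iff_dvd] at h5
  have h6 : (3 : ℤ) ≤ p := by omega
  rcases neg_one_pow_eq_or ℤ m with h7 | h7 <;> rcases hδ with rfl | rfl <;> rw [h7] at h5 ⊢ <;>
    exfalso <;> revert h5 <;> norm_num <;> intro h5 <;> have := Int.le_of_dvd (by norm_num) h5 <;> omega

theorem pow_mul_pow_sub_one_eq {p m : ℕ} (hpm : p = 2 * m + 1) (r : ℕ) :
    Complex.exp (2 * Real.pi * Complex.I / p) ^ (r * m)
        * (Complex.exp (2 * Real.pi * Complex.I / p) ^ r - 1)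
      = (-1) ^ r * (Complex.I * ((2 * Real.sin (Real.pi * r / p) : ℝ) : ℂ)) := by
  have hp : (p : ℂ) ≠ 0 := by
    rw [hpm]
    exact_mod_cast Nat.succ_ne_zero (2 * m)
  have h1 : Complex.exp (2 * Real.pi * Complex.I / p) ^ (r * m)
      = (-1) ^ r * Complex.exp (-(Real.pi * r / p : ℝ) * Complex.I) := by
    rw [← Complex.exp_pi_mul_I, ← Complex.exp_nat_mul, ← Complex.exp_nat_mul, ← Complex.exp_add]
    congr 1
    push_cast
    field_simp
    rw [hpm]
    push_cast
    ring
  have h2 : Complex.exp (2 * Real.pi * Complex.I / p) ^ r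
      = Complex.exp ((Real.pi * r / p : ℝ) * Complex.I)
        * Complex.exp ((Real.pi * r / p : ℝ) * Complex.I) := by
    rw [← Complex.exp_nat_mul, ← Complex.exp_add]
    congr 1
    push_cast
    ring
  have h3 : Complex.exp (-(Real.pi * r / p : ℝ) * Complex.I)
      * Complex.exp ((Real.pi * r / p : ℝ) * Complex.I) = 1 := by
    rw [← Complex.exp_add]
    simp
  have h4 := Complex.two_sin (Real.pi * r / p : ℝ)
  rw [Complex.ofReal_mul, Complex.ofReal_sin, Complex.ofReal_ofNat, h4, h1, h2]
  linear_combination (-1 : ℂ) ^ r * Complex.exp ((Real.pi * r / p : ℝ) * Complex.I) * h3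
    - (-1 : ℂ) ^ r * (Complex.exp (-(Real.pi * r / p : ℝ) * Complex.I)
    - Complex.exp ((Real.pi * r / p : ℝ) * Complex.I)) * Complex.I_sq

theorem prod_two_sin_pos {p m : ℕ} (hpm : p = 2 * m + 1) :
    0 < ∏ r ∈ Finset.range m, (2 * Real.sin (Real.pi * (r + 1 : ℕ) / p)) := by
  refine Finset.prod_pos fun r hr => ?_
  have hr : r < m := by simpa using hr
  have hp : (0 : ℝ) < p := by
    rw [hpm]
    positivity
  refine mul_pos two_pos (Real.sin_pos_of_pos_of_lt_pi (by positivity) ?_)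
  rw [div_lt_iff₀ hp]
  refine mul_lt_mul_of_pos_left ?_ Real.pi_pos
  exact_mod_cast (by omega : r + 1 < p)

theorem norm_one_sub_exp_pow {p : ℕ} (hp : 0 < p) {r : ℕ} (hr : r ≤ p) :
    ‖1 - Complex.exp (2 * Real.pi * Complex.I / p) ^ r‖ = 2 * Real.sin (Real.pi * r / p) := by
  have hp' : (0 : ℝ) < p := by exact_mod_cast hp
  have h : Complex.exp (2 * Real.pi * Complex.I / p) ^ r
      = Complex.exp (Complex.I * (2 * (Real.pi * r / p) : ℝ)) := by
    rw [← Complex.exp_nat_mul]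
    congr 1
    push_cast
    ring
  rw [h, norm_sub_rev, Complex.norm_exp_I_mul_ofReal_sub_one, norm_mul, Real.norm_ofNat,
    mul_div_cancel_left₀ _ two_ne_zero, Real.norm_of_nonneg]
  refine Real.sin_nonneg_of_nonneg_of_le_pi (by positivity) ?_
  rw [div_le_iff₀ hp']
  exact mul_le_mul_of_nonneg_left (by exact_mod_cast hr) Real.pi_pos.le

theorem prod_two_sin_sq {p m : ℕ} (hpm : p = 2 * m + 1) :
    (∏ r ∈ Finset.range m, (2 * Real.sin (Real.pi * (r + 1 : ℕ) / p))) ^ 2 = p := by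
  have hp : 0 < p := by omega
  have hp' : (p : ℝ) ≠ 0 := by exact_mod_cast hp.ne'
  have h := IsPrimitiveRoot.prod_one_sub_pow_eq_order (n := 2 * m)
    (μ := Complex.exp (2 * Real.pi * Complex.I / p))
    (by rw [← hpm]; exact Complex.isPrimitiveRoot_exp p hp.ne')
  have h' := congrArg norm h
  rw [norm_prod, Finset.prod_congr rfl fun k hk => norm_one_sub_exp_pow hp (r := k + 1)
    (by have := Finset.mem_range.mp hk; omega)] at h'
  have hn : ‖((2 * m : ℕ) : ℂ) + 1‖ = (p : ℝ) := by
    rw [← Nat.cast_succ, Complex.norm_natCast, hpm]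
  rw [hn, two_mul m, Finset.prod_range_add] at h'
  rw [sq]
  refine Eq.trans ?_ h'
  congr 1
  rw [← Finset.prod_range_reflect]
  refine Finset.prod_congr rfl fun r hr => ?_
  have hr : r < m := by simpa using hr
  rw [← Real.sin_pi_sub]
  congr 2
  field_simp
  rw [show m - 1 - r + 1 = m - r by omega, Nat.cast_sub hr.le, hpm]
  push_cast
  ring

theorem neg_one_pow_mul_prod_eq {p m : ℕ} (hpm : p = 2 * m + 1) :
    (-1) ^ m * ∏ r ∈ Finset.range m, (Complex.exp (2 * Real.pi * Complex.I / p) ^ ((r + 1) * m)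
        * (Complex.exp (2 * Real.pi * Complex.I / p) ^ (r + 1) - 1)) = sqrtPStar p := by
  have hsqrt : Real.sqrt p = ∏ r ∈ Finset.range m, (2 * Real.sin (Real.pi * (r + 1 : ℕ) / p)) := by
    have h := Real.sqrt_sq (prod_two_sin_pos hpm).le
    rwa [prod_two_sin_sq hpm] at h
  have hsign : ∀ k : ℕ, (-1 : ℂ) ^ k * ∏ r ∈ Finset.range k, ((-1) ^ (r + 1) * Complex.I)
      = if Even k then 1 else Complex.I := by
    intro k
    induction k with
    | zero => simp
    | succ k ih =>
      rw [Finset.prod_range_succ, show (-1 : ℂ) ^ (k + 1) * ((∏ r ∈ Finset.range k,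
        ((-1) ^ (r + 1) * Complex.I)) * ((-1) ^ (k + 1) * Complex.I))
        = ((-1 : ℂ) ^ k * ∏ r ∈ Finset.range k, ((-1) ^ (r + 1) * Complex.I))
          * ((-1) ^ k * Complex.I) by ring, ih]
      by_cases hk : Even k
      · simp [hk, Nat.even_add_one]
      · simp [hk, Nat.even_add_one, (Nat.not_even_iff_odd.mp hk).neg_one_pow]
  simp_rw [pow_mul_pow_sub_one_eq hpm]
  simp_rw [← mul_assoc]
  rw [Finset.prod_mul_distrib, ← mul_assoc, hsign, ← Complex.ofReal_prod, ← hsqrt, sqrtPStar]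
  by_cases hk : Even m
  · have : p % 4 = 1 := by
      obtain ⟨t, rfl⟩ := hk
      omega
    simp [hk, this]
  · have : p % 4 ≠ 1 := by
      obtain ⟨t, rfl⟩ := Nat.not_even_iff_odd.mp hk
      omega
    simp [hk, this]

theorem sqrtPStar_sq (p : ℕ) [Fact p.Prime] (hp : p ≠ 2) :
    sqrtPStar p ^ 2 = eta0 p (-1) * p := by
  have h2 : ringChar (ZMod p) ≠ 2 := by rwa [ZMod.ringChar_zmod_n]
  have hodd := (Fact.out : p.Prime).eq_two_or_odd.resolve_left hp
  have hsq : ((Real.sqrt p : ℝ) : ℂ) ^ 2 = p := by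
    rw [← Complex.ofReal_pow, Real.sq_sqrt (Nat.cast_nonneg p), Complex.ofReal_natCast]
  rw [eta0, quadraticChar_neg_one h2, ZMod.card, ZMod.χ₄_nat_eq_if_mod_four, sqrtPStar]
  rcases (by omega : p % 4 = 1 ∨ p % 4 = 3) with h | h
  · simp [h, hodd, hsq]
  · simp [h, hodd, mul_pow, hsq]

theorem eta0_eq_ringHomComp (p : ℕ) [Fact p.Prime] (j : ZMod p) :
    eta0 p j = (quadraticChar (ZMod p)).ringHomComp (Int.castRingHom ℂ) j := rfl

/-- Gauss's evaluation of the quadratic Gauss sum, including its sign. -/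
theorem sum_eta0_mul_ep (p : ℕ) [Fact p.Prime] (hp : p ≠ 2) :
    ∑ j : ZMod p, eta0 p j * ep p j = sqrtPStar p := by
  have hodd := (Fact.out : p.Prime).eq_two_or_odd.resolve_left hp
  obtain ⟨m, hpm⟩ : ∃ m, p = 2 * m + 1 := ⟨p / 2, by omega⟩
  have h2 : ringChar (ZMod p) ≠ 2 := by rwa [ZMod.ringChar_zmod_n]
  have hinj : Function.Injective (Int.castRingHom ℂ) := Int.cast_injective
  have hsq : (∑ j : ZMod p, eta0 p j * ep p j) ^ 2 = sqrtPStar p ^ 2 := by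
    have := gaussSum_sq (χ := (quadraticChar (ZMod p)).ringHomComp (Int.castRingHom ℂ))
      (by rw [Ne, MulChar.ringHomComp_eq_one_iff hinj]; exact quadraticChar_ne_one h2)
      ((quadraticChar_isQuadratic (ZMod p)).comp _) (ZMod.isPrimitive_stdAddChar p)
    rw [ZMod.card, ← eta0_eq_ringHomComp, ← sqrtPStar_sq p hp] at this
    rw [← this, gaussSum]
    simp_rw [ep_eq_stdAddChar, eta0_eq_ringHomComp]
  have hprod := neg_one_pow_mul_prod_eq hpm
  have key (δ : ℤ) (hδ : δ = 1 ∨ δ = -1)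
      (h : ∑ j : ZMod p, eta0 p j * ep p j = δ * sqrtPStar p) : δ = 1 := by
    have hsgn : δ * (-1) ^ m = 1 ∨ δ * (-1) ^ m = -1 := by
      rcases neg_one_pow_eq_or ℤ m with h7 | h7 <;> rcases hδ with rfl | rfl <;> simp [h7]
    have := eq_neg_one_pow_of_sum_eq_prod hpm (δ * (-1) ^ m) hsgn (by
      simp_rw [eta0, ep_eq_pow] at h
      rw [h, ← hprod]
      push_cast
      ring)
    have hne : ((-1 : ℤ) ^ m) ≠ 0 := pow_ne_zero _ (by norm_num)
    exact mul_right_cancel₀ hne (by rw [this, one_mul])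
  rcases sq_eq_sq_iff_eq_or_eq_neg.mp hsq with h | h
  · exact h
  · have := key (-1) (Or.inr rfl) (by simpa using h)
    norm_num at this

end Gauss

section Transfer

open Polynomial

theorem aeval_eq_zero_of_geom_sum_eq_zero {p : ℕ} [Fact p.Prime] {Q : ℤ[X]}
    (h : aeval (Complex.exp (2 * Real.pi * Complex.I / p)) Q = 0)
    {R : Type*} [CommRing R] {r : R} (hr : ∑ i ∈ Finset.range p, r ^ i = 0) :
    aeval r Q = 0 := by
  obtain ⟨S, rfl⟩ := cyclotomic_dvd_of_aeval_eq_zero (Fact.out : p.Prime).pos h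
  simp [cyclotomic_prime, hr]

/-- An evaluation of an exponential sum as a multiple of a power of `√(p*)` is an identity between
integral polynomials in `ξ_p`, hence holds at every root of the `p`-th cyclotomic polynomial. -/
theorem sum_pow_val_eq {p : ℕ} [Fact p.Prime] (hp : p ≠ 2) {ι : Type*} [Fintype ι]
    (a : ι → ZMod p) (b : ZMod p) (m : ℕ) (ε : ℤ)
    (h : ∑ i, ep p (a i) = ε * sqrtPStar p ^ m * ep p b)
    {R : Type*} [CommRing R] {r : R} (hr : ∑ i ∈ Finset.range p, r ^ i = 0) :
    ∑ i, r ^ (a i).val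
      = ε * (∑ j : ZMod p, ((quadraticChar (ZMod p) j : ℤ) : R) * r ^ j.val) ^ m * r ^ b.val := by
  have key := aeval_eq_zero_of_geom_sum_eq_zero (p := p)
    (Q := ∑ i, X ^ (a i).val
      - C ε * (∑ j : ZMod p, C (quadraticChar (ZMod p) j) * X ^ j.val) ^ m * X ^ b.val) (by
      simp only [map_sub, map_sum, map_mul, map_pow, aeval_X, eq_intCast, map_intCast]
      rw [← sum_eta0_mul_ep p hp] at h
      simp_rw [eta0, ep_eq_pow] at h
      exact sub_eq_zero.mpr h) hr
  simp only [map_sub, map_sum, map_mul, map_pow, aeval_X, eq_intCast, map_intCast] at key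
  exact sub_eq_zero.mp key

theorem exists_geom_sum_eq_zero_of_two_eq_zero (p : ℕ) [Fact p.Prime] :
    ∃ (R : Type) (_ : CommRing R) (_ : Nontrivial R) (r : R),
      (2 : R) = 0 ∧ ∑ i ∈ Finset.range p, r ^ i = 0 := by
  have hp' : p.Prime := Fact.out
  have hdeg : (cyclotomic p (ZMod 2)).degree ≠ 0 := by
    rw [degree_cyclotomic, Nat.totient_prime hp']
    have := hp'.two_le
    exact_mod_cast (by omega : p - 1 ≠ 0)
  refine ⟨AdjoinRoot (cyclotomic p (ZMod 2)), inferInstance, AdjoinRoot.nontrivial _ hdeg,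
    AdjoinRoot.root _, ?_, ?_⟩
  · have : (2 : ZMod 2) = 0 := rfl
    have h := congrArg (AdjoinRoot.of (cyclotomic p (ZMod 2))) this
    rwa [map_ofNat, map_zero] at h
  · have := AdjoinRoot.eval₂_root (cyclotomic p (ZMod 2))
    rw [cyclotomic_prime] at this ⊢
    simpa [eval₂_finsetSum] using this

end Transfer

theorem ep_zero (p : ℕ) : ep p 0 = 1 := by simp [ep]

theorem ep_pow_val {p : ℕ} [NeZero p] (y j : ZMod p) : ep p y ^ j.val = ep p (y * j) := by
  rw [ep_eq_stdAddChar, ep_eq_stdAddChar, ← AddChar.map_nsmul_eq_pow, nsmul_eq_mul,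
    ZMod.natCast_zmod_val, mul_comm]

theorem sum_ep_mul {p : ℕ} [Fact p.Prime] (b : ZMod p) :
    ∑ y : ZMod p, ep p (y * b) = if b = 0 then (p : ℂ) else 0 := by
  simp_rw [ep_eq_stdAddChar]
  rw [AddChar.sum_mulShift b (ZMod.isPrimitive_stdAddChar p), ZMod.card]
  split_ifs <;> simp

theorem sum_eta0_mul_ep_mul {p : ℕ} [Fact p.Prime] (hp : p ≠ 2) (b : ZMod p) :
    ∑ y : ZMod p, eta0 p y * ep p (y * b) = eta0 p b * sqrtPStar p := by
  by_cases hb : b = 0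
  · have h2 : ringChar (ZMod p) ≠ 2 := by rwa [ZMod.ringChar_zmod_n]
    subst hb
    have := congrArg (Int.cast : ℤ → ℂ) (quadraticChar_sum_zero h2)
    simp only [mul_zero, ep_zero, mul_one]
    simpa [eta0] using this
  · rw [← sum_eta0_mul_ep p hp, Finset.mul_sum,
      ← Equiv.sum_comp (Equiv.mulRight₀ b hb) (fun j => eta0 p b * (eta0 p j * ep p j))]
    refine Finset.sum_congr rfl fun y _ => ?_
    have hsq : eta0 p b * eta0 p b = 1 := by
      rw [eta0]
      exact_mod_cast (sq (quadraticChar (ZMod p) b)).symm.trans (quadraticChar_sq_one hb)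
    have hmul : eta0 p (y * b) = eta0 p y * eta0 p b := by
      rw [eta0, map_mul, Int.cast_mul]
      rfl
    simp only [Equiv.mulRight₀_apply]
    rw [hmul]
    linear_combination -(eta0 p y * ep p (y * b)) * hsq

/-- The Galois conjugate of an evaluated exponential sum under `ξ_p ↦ ξ_p^y`. -/
theorem sum_ep_mul_eq {p : ℕ} [Fact p.Prime] (hp : p ≠ 2) {ι : Type*} [Fintype ι]
    (a : ι → ZMod p) (b : ZMod p) (m : ℕ) (ε : ℤ)
    (h : ∑ i, ep p (a i) = ε * sqrtPStar p ^ m * ep p b) {y : ZMod p} (hy : y ≠ 0) :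
    ∑ i, ep p (y * a i) = ε * (eta0 p y * sqrtPStar p) ^ m * ep p (y * b) := by
  have hr : ∑ i ∈ Finset.range p, ep p y ^ i = 0 := by
    rw [← sum_zmod_val (fun i => ep p y ^ i)]
    simp_rw [ep_pow_val, mul_comm y, sum_ep_mul, if_neg hy]
  have := sum_pow_val_eq hp a b m ε h hr
  simp_rw [ep_pow_val] at this
  rw [this, ← sum_eta0_mul_ep_mul hp y]
  simp_rw [mul_comm y]
  rfl

theorem two_ne_zero_of_algebra_zmod {p : ℕ} [Fact p.Prime] (hp : p ≠ 2) (F : Type*) [Field F]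
    [Algebra (ZMod p) F] : (2 : F) ≠ 0 := by
  have h : (2 : ZMod p) ≠ 0 := Ring.two_ne_zero (by rwa [ZMod.ringChar_zmod_n])
  rw [← map_ofNat (algebraMap (ZMod p) F) 2]
  exact (map_ne_zero _).mpr h

theorem exponent_eq_zero_of_even_function {p : ℕ} [Fact p.Prime] (hp : p ≠ 2) {F : Type*} [Field F]
    [Fintype F] [Algebra (ZMod p) F] {f : F → ZMod p} (hf0 : f 0 = 0) (hf : ∀ x, f (-x) = f x)
    {b : ZMod p} {m : ℕ} {ε : ℤ} (hε : ε = 1 ∨ ε = -1)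
    (h : ∑ x, ep p (f x) = ε * sqrtPStar p ^ m * ep p b) : b = 0 := by
  obtain ⟨R, _, _, r, h2, hr⟩ := exists_geom_sum_eq_zero_of_two_eq_zero p
  have hneg : (-1 : R) = 1 := by linear_combination -h2
  have key := sum_pow_val_eq hp f b m ε h hr
  have hleft : ∑ x, r ^ (f x).val = 1 := by
    rw [← Finset.add_sum_erase _ _ (Finset.mem_univ (0 : F)), hf0, ZMod.val_zero, pow_zero,
      add_eq_left]
    refine Finset.sum_involution (fun x _ => -x) ?_ ?_ ?_ ?_
    · intro x _
      rw [hf]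
      linear_combination r ^ (f x).val * h2
    · intro x hx _ hxx
      have h3 : (2 : F) * x = 0 := by linear_combination -hxx
      exact (Finset.ne_of_mem_erase hx)
        ((mul_eq_zero.mp h3).resolve_left (two_ne_zero_of_algebra_zmod hp F))
    · intro x hx
      simpa using hx
    · intro x _
      simp
  have hgauss : ∑ j : ZMod p, ((quadraticChar (ZMod p) j : ℤ) : R) * r ^ j.val = 1 := by
    have hs : ∑ j : ZMod p, r ^ j.val = 0 := by rw [sum_zmod_val (fun i => r ^ i), hr]
    rw [← Finset.add_sum_erase _ _ (Finset.mem_univ (0 : ZMod p))] at hs ⊢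
    rw [ZMod.val_zero, pow_zero] at hs
    have : ∑ j ∈ Finset.univ.erase (0 : ZMod p),
        ((quadraticChar (ZMod p) j : ℤ) : R) * r ^ j.val
        = ∑ j ∈ Finset.univ.erase (0 : ZMod p), r ^ j.val := by
      refine Finset.sum_congr rfl fun j hj => ?_
      rcases quadraticChar_dichotomy (Finset.ne_of_mem_erase hj) with h4 | h4 <;>
        simp only [h4] <;> simp [hneg]
    rw [this, MulChar.map_zero]
    push_cast
    linear_combination hs - h2
  have hε' : (ε : R) = 1 := by
    rcases hε with rfl | rfl <;> simp [hneg]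
  rw [hleft, hgauss, hε', one_pow, one_mul, one_mul] at key
  by_contra hb
  have hrp : r ^ p = 1 := by
    have := geom_sum_mul r p
    rw [hr, zero_mul] at this
    exact (sub_eq_zero.mp this.symm)
  have hcop : Nat.Coprime p b.val :=
    ((Fact.out : p.Prime).coprime_iff_not_dvd).mpr fun hd =>
      absurd (Nat.le_of_dvd (Nat.pos_of_ne_zero (by simpa using hb)) hd) (not_le.mpr b.val_lt)
  have hr1 : r = 1 := by
    have := pow_gcd_eq_one (a := r) (m := p) (n := b.val) |>.mpr ⟨hrp, key.symm⟩
    rwa [hcop, pow_one] at this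
  have hodd := (Fact.out : p.Prime).odd_of_ne_two hp
  obtain ⟨k, hk⟩ := hodd
  rw [hr1, hk] at hr
  simp [h2] at hr

theorem sum_eq_zero_add_sum_units {K M : Type*} [Field K] [Fintype K] [Fintype Kˣ]
    [AddCommMonoid M]
    (φ : K → M) : ∑ z, φ z = φ 0 + ∑ u : Kˣ, φ u := by
  rw [← Finset.add_sum_erase _ _ (Finset.mem_univ (0 : K))]
  congr 1
  symm
  refine Finset.sum_bij (fun u _ => (u : K)) ?_ ?_ ?_ ?_
  · intro u _; simp
  · intro u _ v _ h; exact Units.ext h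
  · intro z hz; exact ⟨Units.mk0 z (Finset.ne_of_mem_erase hz), Finset.mem_univ _, rfl⟩
  · intro u _; rfl

section Counting

variable {p : ℕ} [Fact p.Prime] {F : Type*} [Field F] [Fintype F] [Algebra (ZMod p) F]

theorem ep_add (a b : ZMod p) : ep p (a + b) = ep p a * ep p b := by
  simp_rw [ep_eq_stdAddChar]
  exact AddChar.map_add_eq_mul _ a b

/-- `∑_{z ∈ F_p} ∑_{x ∈ F_q} ξ_p^{y f(x) - z Tr(βx)}`. -/
def hyperplaneSum (f : F → ZMod p) (β : F) (y : ZMod p) : ℂ :=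
  ∑ z : ZMod p, ∑ x : F, ep p (y * f x - z * Algebra.trace (ZMod p) F (β * x))

theorem hyperplaneSum_eq (f : F → ZMod p) (β : F) (y : ZMod p) :
    hyperplaneSum f β y
      = p * ∑ x with Algebra.trace (ZMod p) F (β * x) = 0, ep p (y * f x) := by
  rw [hyperplaneSum, Finset.sum_comm, Finset.sum_filter, Finset.mul_sum]
  refine Finset.sum_congr rfl fun x _ => ?_
  have h (z : ZMod p) : ep p (y * f x - z * Algebra.trace (ZMod p) F (β * x))
      = ep p (y * f x) * ep p (z * -Algebra.trace (ZMod p) F (β * x)) := by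
    rw [← ep_add]
    congr 1
    ring
  simp_rw [h, ← Finset.mul_sum, sum_ep_mul, neg_eq_zero]
  split_ifs <;> ring

theorem sum_ep_trace {a : F} (ha : a ≠ 0) :
    ∑ x : F, ep p (Algebra.trace (ZMod p) F (a * x)) = 0 := by
  let ψ : AddChar F ℂ := ZMod.stdAddChar.compAddMonoidHom
    ((Algebra.trace (ZMod p) F).toAddMonoidHom.comp (AddMonoidHom.mulLeft a))
  have hψ : ψ ≠ 1 := by
    obtain ⟨t, ht⟩ := Algebra.trace_surjective (ZMod p) F 1
    rw [AddChar.ne_one_iff]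
    refine ⟨a⁻¹ * t, fun h => ?_⟩
    have h' : ZMod.stdAddChar (Algebra.trace (ZMod p) F (a * (a⁻¹ * t))) = (1 : ℂ) := h
    rw [mul_inv_cancel_left₀ ha, ht, ← AddChar.map_zero_eq_one (ZMod.stdAddChar (N := p)),
      ZMod.injective_stdAddChar.eq_iff] at h'
    exact one_ne_zero h'
  have := AddChar.sum_eq_zero_of_ne_one hψ
  simp_rw [ep_eq_stdAddChar]
  exact this

theorem hyperplaneSum_zero (f : F → ZMod p) {β : F} (hβ : β ≠ 0) :
    hyperplaneSum f β 0 = Fintype.card F := by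
  have h (u : (ZMod p)ˣ) :
      ∑ x : F, ep p (0 * f x - u * Algebra.trace (ZMod p) F (β * x)) = 0 := by
    have hu : algebraMap (ZMod p) F (-(u : ZMod p)) * β ≠ 0 :=
      mul_ne_zero ((map_ne_zero _).mpr (neg_ne_zero.mpr u.ne_zero)) hβ
    rw [← sum_ep_trace (p := p) hu]
    refine Finset.sum_congr rfl fun x _ => ?_
    congr 1
    rw [mul_assoc, ← Algebra.smul_def, map_smul, smul_eq_mul]
    ring
  rw [hyperplaneSum, sum_eq_zero_add_sum_units]
  simp_rw [h]
  simp [ep_zero]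

theorem eta0_mul_self {u : ZMod p} (hu : u ≠ 0) : eta0 p u * eta0 p u = 1 := by
  rw [eta0]
  exact_mod_cast (sq (quadraticChar (ZMod p) u)).symm.trans (quadraticChar_sq_one hu)

theorem eta0_mul (a b : ZMod p) : eta0 p (a * b) = eta0 p a * eta0 p b := by
  rw [eta0, map_mul, Int.cast_mul]
  rfl

theorem eta0_units_pow_mul {h : ℕ} (hh : Even h) (c : (ZMod p)ˣ) (b : ZMod p) :
    eta0 p (((c ^ h : (ZMod p)ˣ) : ZMod p) * b) = eta0 p b := by
  obtain ⟨k, rfl⟩ := hh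
  rw [eta0_mul, pow_add, Units.val_mul, eta0_mul, eta0_mul_self (Units.ne_zero _), one_mul]

theorem walsh_homogeneous {h : ℕ} (hh : 0 < h) {f : F → ZMod p}
    (hf : ∀ (a : (ZMod p)ˣ) (x : F),
      f (algebraMap (ZMod p) F (a : ZMod p) * x) = (a : ZMod p) ^ h * f x)
    (β : F) (y : ZMod p) (c : (ZMod p)ˣ) :
    ∑ x : F, ep p (y * f x - (y * (c : ZMod p) ^ (h - 1)) * Algebra.trace (ZMod p) F (β * x))
      = ∑ x : F, ep p (y * (c : ZMod p) ^ h * (f x - Algebra.trace (ZMod p) F (β * x))) := by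
  have hc : algebraMap (ZMod p) F (c : ZMod p) ≠ 0 := (map_ne_zero _).mpr c.ne_zero
  rw [← Equiv.sum_comp (Equiv.mulLeft₀ _ hc)]
  refine Finset.sum_congr rfl fun x _ => ?_
  congr 1
  rw [Equiv.mulLeft₀_apply, hf, mul_left_comm β, ← Algebra.smul_def, map_smul, smul_eq_mul]
  obtain ⟨k, rfl⟩ := Nat.exists_eq_add_of_le' hh
  simp only [Nat.add_sub_cancel]
  ring

theorem hyperplaneSum_unit (hp : p ≠ 2) {h m : ℕ} (hh : 0 < h) (heven : Even h)
    (hcop : Nat.gcd (h - 1) (p - 1) = 1) {f : F → ZMod p}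
    (hf : ∀ (a : (ZMod p)ˣ) (x : F),
      f (algebraMap (ZMod p) F (a : ZMod p) * x) = (a : ZMod p) ^ h * f x)
    {ε ε' : ℤ} (h0 : walsh p f 0 = ε * sqrtPStar p ^ m) {β : F} {b : ZMod p}
    (hβ : walsh p f β = ε' * sqrtPStar p ^ m * ep p b) (y : (ZMod p)ˣ) :
    hyperplaneSum f β y = sqrtPStar p ^ m * eta0 p y ^ m
      * (ε + ε' * ∑ c : (ZMod p)ˣ, ep p (y * ((c ^ h : (ZMod p)ˣ) * b))) := by
  rw [hyperplaneSum, sum_eq_zero_add_sum_units]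
  have hzero : ∑ x : F, ep p (y * f x - 0 * Algebra.trace (ZMod p) F (β * x))
      = ε * (eta0 p y * sqrtPStar p) ^ m := by
    have := sum_ep_mul_eq hp f 0 m ε (by simpa [walsh, ep_zero] using h0) y.ne_zero
    simpa [ep_zero] using this
  have hcard : (Nat.card (ZMod p)ˣ).Coprime (h - 1) := by
    rw [Nat.card_eq_fintype_card, ZMod.card_units, Nat.Coprime, Nat.gcd_comm]
    exact hcop
  rw [hzero, ← Equiv.sum_comp ((powCoprime hcard).trans (Equiv.mulLeft y)), mul_add,
    Finset.mul_sum, Finset.mul_sum]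
  congr 1
  · ring
  · refine Finset.sum_congr rfl fun c _ => ?_
    have hne : (y : ZMod p) * (c : ZMod p) ^ h ≠ 0 := mul_ne_zero y.ne_zero (pow_ne_zero _ c.ne_zero)
    have h1 := sum_ep_mul_eq hp (fun x => f x - Algebra.trace (ZMod p) F (β * x)) b m ε' hβ hne
    have h2 := eta0_units_pow_mul heven c y
    simp only [Equiv.trans_apply, powCoprime_apply, Equiv.coe_mulLeft, Units.val_mul,
      Units.val_pow_eq_pow_val] at h2 ⊢
    rw [walsh_homogeneous hh hf, h1, mul_comm (y : ZMod p), h2, mul_pow, mul_comm (_ ^ h : ZMod p),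
      mul_assoc (y : ZMod p)]
    ring

/-- `p²` times the number of zeros of `f` with `Tr(βx) = 0`, as a sum of hyperplane sums. -/
theorem sum_hyperplaneSum (f : F → ZMod p) (β : F) :
    ∑ y, hyperplaneSum f β y
      = (p : ℂ) ^ 2 * ((Finset.univ.filter fun x : F => f x = 0 ∧ Algebra.trace (ZMod p) F (β * x) = 0).card : ℂ) := by
  simp_rw [hyperplaneSum_eq]
  rw [← Finset.mul_sum, Finset.sum_comm]
  simp_rw [sum_ep_mul]
  rw [Finset.sum_ite, Finset.sum_const_zero, add_zero, Finset.sum_const, Finset.filter_filter]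
  simp_rw [and_comm (b := f _ = 0)]
  rw [nsmul_eq_mul]
  ring

theorem eta0_eq_ite (j : ZMod p) :
    eta0 p j = (if j ≠ 0 ∧ IsSquare j then 1 else 0) - (if j ≠ 0 ∧ ¬ IsSquare j then 1 else 0) := by
  rw [eta0, quadraticChar_apply, quadraticCharFun]
  by_cases hj : j = 0 <;> by_cases hs : IsSquare j <;> simp [hj, hs]

theorem eta0_zero : eta0 p 0 = 0 := by simp [eta0]

theorem eta0_of_isSquare {j : ZMod p} (hj : j ≠ 0 ∧ IsSquare j) : eta0 p j = 1 := by
  simp [eta0_eq_ite, hj]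

theorem eta0_of_not_isSquare {j : ZMod p} (hj : j ≠ 0 ∧ ¬ IsSquare j) : eta0 p j = -1 := by
  simp [eta0_eq_ite, hj]

theorem sum_eta0_mul_hyperplaneSum (hp : p ≠ 2) (f : F → ZMod p) (β : F) :
    ∑ y, eta0 p y * hyperplaneSum f β y = p * sqrtPStar p *
      (((Finset.univ.filter fun x : F => (f x ≠ 0 ∧ IsSquare (f x)) ∧ Algebra.trace (ZMod p) F (β * x) = 0).card : ℂ)
        - (Finset.univ.filter fun x : F => (f x ≠ 0 ∧ ¬ IsSquare (f x)) ∧ Algebra.trace (ZMod p) F (β * x) = 0).card) := by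
  simp_rw [hyperplaneSum_eq, Finset.mul_sum]
  rw [Finset.sum_comm]
  simp_rw [mul_left_comm _ (p : ℂ), ← Finset.mul_sum, sum_eta0_mul_ep_mul hp]
  rw [Finset.card_filter, Finset.card_filter, Finset.sum_filter, Nat.cast_sum, Nat.cast_sum,
    ← Finset.sum_sub_distrib, Finset.mul_sum, Finset.mul_sum]
  refine Finset.sum_congr rfl fun x _ => ?_
  rw [eta0_eq_ite]
  by_cases h0 : f x = 0 <;> by_cases hs : IsSquare (f x) <;>
    by_cases ht : Algebra.trace (ZMod p) F (β * x) = 0 <;> simp [h0, hs, ht]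

theorem card_filter_trace_eq (f : F → ZMod p) (β : F) :
    (Finset.univ.filter fun x : F => Algebra.trace (ZMod p) F (β * x) = 0).card
      = (Finset.univ.filter fun x : F => f x = 0 ∧ Algebra.trace (ZMod p) F (β * x) = 0).card
        + (Finset.univ.filter fun x : F => (f x ≠ 0 ∧ IsSquare (f x)) ∧ Algebra.trace (ZMod p) F (β * x) = 0).card
        + (Finset.univ.filter fun x : F => (f x ≠ 0 ∧ ¬ IsSquare (f x)) ∧ Algebra.trace (ZMod p) F (β * x) = 0).card := by
  simp_rw [Finset.card_filter]
  rw [← Finset.sum_add_distrib, ← Finset.sum_add_distrib]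
  refine Finset.sum_congr rfl fun x _ => ?_
  by_cases h0 : f x = 0 <;> by_cases hs : IsSquare (f x) <;>
    by_cases ht : Algebra.trace (ZMod p) F (β * x) = 0 <;> simp [h0, hs, ht]

theorem sum_units_ep_mul (b : ZMod p) :
    ∑ u : (ZMod p)ˣ, ep p (u * b) = (if b = 0 then (p : ℂ) else 0) - 1 := by
  rw [← sum_ep_mul, sum_eq_zero_add_sum_units (K := ZMod p), zero_mul, ep_zero, add_sub_cancel_left]

theorem sum_units_eta0_mul_ep_mul (hp : p ≠ 2) (b : ZMod p) :
    ∑ u : (ZMod p)ˣ, eta0 p u * ep p (u * b) = eta0 p b * sqrtPStar p := by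
  rw [← sum_eta0_mul_ep_mul hp, sum_eq_zero_add_sum_units (K := ZMod p)]
  simp [eta0]

theorem sum_units_mul_hyperplaneSum (hp : p ≠ 2) {h m : ℕ} (hh : 0 < h) (heven : Even h)
    (hcop : Nat.gcd (h - 1) (p - 1) = 1) {f : F → ZMod p}
    (hf : ∀ (a : (ZMod p)ˣ) (x : F),
      f (algebraMap (ZMod p) F (a : ZMod p) * x) = (a : ZMod p) ^ h * f x)
    {ε ε' : ℤ} (h0 : walsh p f 0 = ε * sqrtPStar p ^ m) {β : F} {b : ZMod p}
    (hβ : walsh p f β = ε' * sqrtPStar p ^ m * ep p b) (φ : (ZMod p)ˣ → ℂ) (T : ZMod p → ℂ)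
    (hT : ∀ a, ∑ u : (ZMod p)ˣ, φ u * eta0 p u ^ m * ep p (u * a) = T a)
    (hTb : ∀ c : (ZMod p)ˣ, T ((c ^ h : (ZMod p)ˣ) * b) = T b) :
    ∑ u : (ZMod p)ˣ, φ u * hyperplaneSum f β u
      = sqrtPStar p ^ m * (ε * T 0 + ε' * ((p - 1) * T b)) := by
  have hcard : ∑ _c : (ZMod p)ˣ, T b = (p - 1) * T b := by
    rw [Finset.sum_const, Finset.card_univ, ZMod.card_units, nsmul_eq_mul,
      Nat.cast_sub (Fact.out : p.Prime).one_le, Nat.cast_one]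
  rw [← hcard, ← Finset.sum_congr rfl fun c _ => (hT _).trans (hTb c), Finset.sum_comm, ← hT 0]
  simp_rw [hyperplaneSum_unit hp hh heven hcop hf h0 hβ, mul_zero, ep_zero, mul_add,
    Finset.mul_sum]
  rw [Finset.sum_add_distrib]
  congr 1
  · exact Finset.sum_congr rfl fun u _ => by ring
  · exact Finset.sum_congr rfl fun u _ => Finset.sum_congr rfl fun c _ => by ring

theorem sqrtPStar_ne_zero (hp : p ≠ 2) : sqrtPStar p ≠ 0 := by
  intro h
  have h1 := sqrtPStar_sq p hp
  have h2 := eta0_mul_self (p := p) (neg_ne_zero.mpr one_ne_zero)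
  have h3 : (p : ℂ) ≠ 0 := Nat.cast_ne_zero.mpr (Fact.out : p.Prime).ne_zero
  rw [h, zero_pow two_ne_zero, zero_eq_mul, or_iff_left h3] at h1
  simp [h1] at h2

/-- The two counts, in terms of the sums `T₁`, `T₂` of `ξ_p^{ua}` weighted by `η₀(u)^m`
and `η₀(u)^{m+1}`. -/
theorem two_mul_card_filter_trace (hp : p ≠ 2) {h m n : ℕ} (hh : 0 < h) (heven : Even h)
    (hcop : Nat.gcd (h - 1) (p - 1) = 1) (hq : Fintype.card F = p ^ n) {f : F → ZMod p}
    (hf : ∀ (a : (ZMod p)ˣ) (x : F),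
      f (algebraMap (ZMod p) F (a : ZMod p) * x) = (a : ZMod p) ^ h * f x)
    {ε ε' : ℤ} (h0 : walsh p f 0 = ε * sqrtPStar p ^ m) {β : F} (hβ0 : β ≠ 0) {b : ZMod p}
    (hβ : walsh p f β = ε' * sqrtPStar p ^ m * ep p b) {T₁ T₂ : ZMod p → ℂ}
    (hT₁ : ∀ a, ∑ u : (ZMod p)ˣ, eta0 p u ^ m * ep p (u * a) = T₁ a)
    (hT₁b : ∀ c : (ZMod p)ˣ, T₁ ((c ^ h : (ZMod p)ˣ) * b) = T₁ b)
    (hT₂ : ∀ a, ∑ u : (ZMod p)ˣ, eta0 p u * eta0 p u ^ m * ep p (u * a) = T₂ a)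
    (hT₂b : ∀ c : (ZMod p)ˣ, T₂ ((c ^ h : (ZMod p)ˣ) * b) = T₂ b) :
    2 * (p : ℂ) ^ 2 * ((Finset.univ.filter fun x : F => (f x ≠ 0 ∧ IsSquare (f x)) ∧ Algebra.trace (ZMod p) F (β * x) = 0).card : ℂ)
        = (p - 1) * (p : ℂ) ^ n - sqrtPStar p ^ m * (ε * T₁ 0 + ε' * ((p - 1) * T₁ b))
          + eta0 p (-1) * sqrtPStar p * (sqrtPStar p ^ m * (ε * T₂ 0 + ε' * ((p - 1) * T₂ b))) ∧
    2 * (p : ℂ) ^ 2 * ((Finset.univ.filter fun x : F => (f x ≠ 0 ∧ ¬ IsSquare (f x)) ∧ Algebra.trace (ZMod p) F (β * x) = 0).card : ℂ)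
        = (p - 1) * (p : ℂ) ^ n - sqrtPStar p ^ m * (ε * T₁ 0 + ε' * ((p - 1) * T₁ b))
          - eta0 p (-1) * sqrtPStar p * (sqrtPStar p ^ m * (ε * T₂ 0 + ε' * ((p - 1) * T₂ b))) := by
  have hZ := sum_hyperplaneSum f β
  have hD := sum_eta0_mul_hyperplaneSum hp f β
  rw [sum_eq_zero_add_sum_units] at hZ hD
  have s₁ := sum_units_mul_hyperplaneSum hp hh heven hcop hf h0 hβ (fun _ => 1) T₁
    (by simpa using hT₁) hT₁b
  have s₂ := sum_units_mul_hyperplaneSum hp hh heven hcop hf h0 hβ (fun u => eta0 p u) T₂ hT₂ hT₂b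
  simp only [one_mul] at s₁
  have hP : (p : ℂ) * ((Finset.univ.filter fun x : F => Algebra.trace (ZMod p) F (β * x) = 0).card : ℂ)
      = (p : ℂ) ^ n := by
    have := hyperplaneSum_zero f hβ0
    rw [hyperplaneSum_eq, hq] at this
    simpa [ep_zero] using this
  rw [hyperplaneSum_zero f hβ0, hq, s₁, Nat.cast_pow] at hZ
  rw [eta0_zero, zero_mul, zero_add, s₂] at hD
  rw [card_filter_trace_eq f β, Nat.cast_add, Nat.cast_add] at hP
  have hG := sqrtPStar_sq p hp
  have he := eta0_mul_self (p := p) (neg_ne_zero.mpr one_ne_zero)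
  rw [hD]
  generalize ((Finset.univ.filter fun x : F => (f x ≠ 0 ∧ IsSquare (f x)) ∧ Algebra.trace (ZMod p) F (β * x) = 0).card : ℂ) = A at *
  generalize ((Finset.univ.filter fun x : F => (f x ≠ 0 ∧ ¬ IsSquare (f x)) ∧ Algebra.trace (ZMod p) F (β * x) = 0).card : ℂ) = B at *
  constructor
  · linear_combination (p : ℂ) * hP + hZ - eta0 p (-1) * p * (A - B) * hG - p ^ 2 * (A - B) * he
  · linear_combination (p : ℂ) * hP + hZ + eta0 p (-1) * p * (A - B) * hG + p ^ 2 * (A - B) * he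

theorem ite_units_mul (c : (ZMod p)ˣ) (b : ZMod p) :
    ((if (c : ZMod p) * b = 0 then (p : ℂ) else 0) - 1) = (if b = 0 then (p : ℂ) else 0) - 1 := by
  simp

theorem two_mul_card_of_even (hp : p ≠ 2) {h m n : ℕ} (hh : 0 < h) (heven : Even h)
    (hcop : Nat.gcd (h - 1) (p - 1) = 1) (hq : Fintype.card F = p ^ n) {f : F → ZMod p}
    (hf : ∀ (a : (ZMod p)ˣ) (x : F),
      f (algebraMap (ZMod p) F (a : ZMod p) * x) = (a : ZMod p) ^ h * f x)
    {ε ε' : ℤ} (h0 : walsh p f 0 = ε * sqrtPStar p ^ m) {β : F} (hβ0 : β ≠ 0) {b : ZMod p}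
    (hβ : walsh p f β = ε' * sqrtPStar p ^ m * ep p b) (hm : Even m) :
    2 * (p : ℂ) ^ 2 * ((Finset.univ.filter fun x : F => (f x ≠ 0 ∧ IsSquare (f x)) ∧ Algebra.trace (ZMod p) F (β * x) = 0).card : ℂ)
        = (p - 1) * ((p : ℂ) ^ n - sqrtPStar p ^ m * (ε + ε' * ((if b = 0 then (p : ℂ) else 0) - 1))
          + sqrtPStar p ^ m * p * (ε' * eta0 p b)) ∧
    2 * (p : ℂ) ^ 2 * ((Finset.univ.filter fun x : F => (f x ≠ 0 ∧ ¬ IsSquare (f x)) ∧ Algebra.trace (ZMod p) F (β * x) = 0).card : ℂ)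
        = (p - 1) * ((p : ℂ) ^ n - sqrtPStar p ^ m * (ε + ε' * ((if b = 0 then (p : ℂ) else 0) - 1))
          - sqrtPStar p ^ m * p * (ε' * eta0 p b)) := by
  have hu (u : (ZMod p)ˣ) : eta0 p u ^ m = 1 := by
    obtain ⟨k, rfl⟩ := hm
    rw [← two_mul, pow_mul, sq, eta0_mul_self u.ne_zero, one_pow]
  have hG := sqrtPStar_sq p hp
  have he := eta0_mul_self (p := p) (neg_ne_zero.mpr one_ne_zero)
  obtain ⟨h₁, h₂⟩ := two_mul_card_filter_trace hp hh heven hcop hq hf h0 hβ0 hβ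
    (T₁ := fun a => (if a = 0 then (p : ℂ) else 0) - 1) (T₂ := fun a => eta0 p a * sqrtPStar p)
    (fun a => by simp_rw [hu, one_mul, sum_units_ep_mul]) (fun c => ite_units_mul _ b)
    (fun a => by simp_rw [hu, mul_one, sum_units_eta0_mul_ep_mul hp])
    (fun c => by rw [eta0_units_pow_mul heven])
  rw [h₁, h₂, if_pos rfl, eta0_zero]
  constructor
  · linear_combination (p - 1) * (sqrtPStar p ^ m * (ε' * eta0 p b)) * (eta0 p (-1) * hG + p * he)
  · linear_combination
      -((p - 1) * (sqrtPStar p ^ m * (ε' * eta0 p b)) * (eta0 p (-1) * hG + p * he))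

theorem two_mul_card_of_odd (hp : p ≠ 2) {h m n : ℕ} (hh : 0 < h) (heven : Even h)
    (hcop : Nat.gcd (h - 1) (p - 1) = 1) (hq : Fintype.card F = p ^ n) {f : F → ZMod p}
    (hf : ∀ (a : (ZMod p)ˣ) (x : F),
      f (algebraMap (ZMod p) F (a : ZMod p) * x) = (a : ZMod p) ^ h * f x)
    {ε ε' : ℤ} (h0 : walsh p f 0 = ε * sqrtPStar p ^ m) {β : F} (hβ0 : β ≠ 0) {b : ZMod p}
    (hβ : walsh p f β = ε' * sqrtPStar p ^ m * ep p b) (hm : Odd m) :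
    2 * (p : ℂ) ^ 2 * ((Finset.univ.filter fun x : F => (f x ≠ 0 ∧ IsSquare (f x)) ∧ Algebra.trace (ZMod p) F (β * x) = 0).card : ℂ)
        = (p - 1) * ((p : ℂ) ^ n - sqrtPStar p ^ m * sqrtPStar p * (ε' * eta0 p b)
          + eta0 p (-1) * (sqrtPStar p ^ m * sqrtPStar p)
            * (ε + ε' * ((if b = 0 then (p : ℂ) else 0) - 1))) ∧
    2 * (p : ℂ) ^ 2 * ((Finset.univ.filter fun x : F => (f x ≠ 0 ∧ ¬ IsSquare (f x)) ∧ Algebra.trace (ZMod p) F (β * x) = 0).card : ℂ)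
        = (p - 1) * ((p : ℂ) ^ n - sqrtPStar p ^ m * sqrtPStar p * (ε' * eta0 p b)
          - eta0 p (-1) * (sqrtPStar p ^ m * sqrtPStar p)
            * (ε + ε' * ((if b = 0 then (p : ℂ) else 0) - 1))) := by
  have hu (u : (ZMod p)ˣ) : eta0 p u ^ m = eta0 p u := by
    obtain ⟨k, rfl⟩ := hm
    rw [pow_succ, pow_mul, sq, eta0_mul_self u.ne_zero, one_pow, one_mul]
  obtain ⟨h₁, h₂⟩ := two_mul_card_filter_trace hp hh heven hcop hq hf h0 hβ0 hβ
    (T₁ := fun a => eta0 p a * sqrtPStar p) (T₂ := fun a => (if a = 0 then (p : ℂ) else 0) - 1)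
    (fun a => by simp_rw [hu, sum_units_eta0_mul_ep_mul hp])
    (fun c => by rw [eta0_units_pow_mul heven])
    (fun a => by
      simp_rw [hu, eta0_mul_self (p := p) (Units.ne_zero _), one_mul, sum_units_ep_mul])
    (fun c => ite_units_mul _ b)
  rw [h₁, h₂, if_pos rfl, eta0_zero]
  constructor <;> ring

end Counting

theorem zpow_sub_of_sq_eq {G e P : ℂ} (hG0 : G ≠ 0) (hG : G ^ 2 = e * P)
    (he : e * e = 1) (n s : ℕ) :
    P ^ 2 * G ^ ((n : ℤ) + s - 4) = G ^ (n + s) ∧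
    P ^ 2 * G ^ ((n : ℤ) + s - 3) = G ^ (n + s) * G ∧
    P ^ 2 * G ^ ((n : ℤ) + s - 2) = G ^ (n + s) * (e * P) ∧
    P ^ 2 * G ^ ((n : ℤ) + s - 1) = G ^ (n + s) * G * (e * P) := by
  have h4 : P ^ 2 = G ^ (4 : ℤ) := by
    rw [show (4 : ℤ) = ((4 : ℕ) : ℤ) from rfl, zpow_natCast]
    linear_combination (-(G ^ 2) - e * P) * hG - P ^ 2 * he
  rw [h4, ← hG, ← zpow_natCast, ← zpow_natCast, ← zpow_add₀ hG0, ← zpow_add₀ hG0, ← zpow_add₀ hG0,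
    ← zpow_add₀ hG0, ← zpow_add₀ hG0, ← zpow_add_one₀ hG0, ← zpow_add₀ hG0]
  push_cast
  refine ⟨?_, ?_, ?_, ?_⟩ <;> congr 1 <;> ring

theorem eq_half_mul_of_two_mul {P N X Y : ℂ} {n : ℕ} (hP : P ≠ 0)
    (h : 2 * P ^ 2 * N = (P - 1) * (P ^ n + Y)) (hX : P ^ 2 * X = Y) :
    N = (P - 1) / 2 * (P ^ ((n : ℤ) - 2) + X) := by
  have h2 : P ^ 2 * P ^ ((n : ℤ) - 2) = P ^ n := by
    rw [← zpow_natCast, ← zpow_natCast, ← zpow_add₀ hP]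
    congr 1
    push_cast
    ring
  have hne : 2 * P ^ 2 ≠ 0 := mul_ne_zero two_ne_zero (pow_ne_zero 2 hP)
  apply mul_left_cancel₀ hne
  rw [h, ← hX, ← h2]
  ring

theorem statement_9 (p n s : ℕ) [Fact p.Prime] (hp : p ≠ 2) (hn : 0 < n) (hs : s ≤ n)
    {F : Type*} [Field F] [Fintype F] [Algebra (ZMod p) F]
    (hq : Fintype.card F = p ^ n)
    (f g : F → ZMod p) (ε : ℂ)
    (hf : IsWRP p n s f ε g) :
    ∀ β : F, β ≠ 0 →
      (walsh p f β = 0 →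
        (Even (n + s) →
          ((Finset.univ.filter fun x : F => (f x ≠ 0 ∧ IsSquare (f x)) ∧ Algebra.trace (ZMod p) F (β * x) = 0).card : ℂ)
            = (((p : ℂ) - 1) / 2) * ((p : ℂ) ^ ((n : ℤ) - 2) - ε * sqrtPStar p ^ ((n : ℤ) + s - 4)) ∧
          ((Finset.univ.filter fun x : F => (f x ≠ 0 ∧ ¬ IsSquare (f x)) ∧ Algebra.trace (ZMod p) F (β * x) = 0).card : ℂ)
            = (((p : ℂ) - 1) / 2) * ((p : ℂ) ^ ((n : ℤ) - 2) - ε * sqrtPStar p ^ ((n : ℤ) + s - 4))) ∧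
        (Odd (n + s) →
          ((Finset.univ.filter fun x : F => (f x ≠ 0 ∧ IsSquare (f x)) ∧ Algebra.trace (ZMod p) F (β * x) = 0).card : ℂ)
            = (((p : ℂ) - 1) / 2) * ((p : ℂ) ^ ((n : ℤ) - 2)
                + ε * eta0 p (-1) * sqrtPStar p ^ ((n : ℤ) + s - 3)) ∧
          ((Finset.univ.filter fun x : F => (f x ≠ 0 ∧ ¬ IsSquare (f x)) ∧ Algebra.trace (ZMod p) F (β * x) = 0).card : ℂ)
            = (((p : ℂ) - 1) / 2) * ((p : ℂ) ^ ((n : ℤ) - 2)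
                - ε * eta0 p (-1) * sqrtPStar p ^ ((n : ℤ) + s - 3)))) ∧
      (walsh p f β ≠ 0 →
        (Even (n + s) →
          (g β = 0 ∨ (g β ≠ 0 ∧ ¬ IsSquare (g β)) →
            ((Finset.univ.filter fun x : F => (f x ≠ 0 ∧ IsSquare (f x)) ∧ Algebra.trace (ZMod p) F (β * x) = 0).card : ℂ)
              = (((p : ℂ) - 1) / 2) * ((p : ℂ) ^ ((n : ℤ) - 2)
                  - ε * eta0 p (-1) * sqrtPStar p ^ ((n : ℤ) + s - 2))) ∧
          (g β ≠ 0 ∧ IsSquare (g β) →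
            ((Finset.univ.filter fun x : F => (f x ≠ 0 ∧ IsSquare (f x)) ∧ Algebra.trace (ZMod p) F (β * x) = 0).card : ℂ)
              = (((p : ℂ) - 1) / 2) * ((p : ℂ) ^ ((n : ℤ) - 2)
                  + ε * eta0 p (-1) * sqrtPStar p ^ ((n : ℤ) + s - 2))) ∧
          (g β = 0 ∨ (g β ≠ 0 ∧ IsSquare (g β)) →
            ((Finset.univ.filter fun x : F => (f x ≠ 0 ∧ ¬ IsSquare (f x)) ∧ Algebra.trace (ZMod p) F (β * x) = 0).card : ℂ)
              = (((p : ℂ) - 1) / 2) * ((p : ℂ) ^ ((n : ℤ) - 2)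
                  - ε * eta0 p (-1) * sqrtPStar p ^ ((n : ℤ) + s - 2))) ∧
          (g β ≠ 0 ∧ ¬ IsSquare (g β) →
            ((Finset.univ.filter fun x : F => (f x ≠ 0 ∧ ¬ IsSquare (f x)) ∧ Algebra.trace (ZMod p) F (β * x) = 0).card : ℂ)
              = (((p : ℂ) - 1) / 2) * ((p : ℂ) ^ ((n : ℤ) - 2)
                  + ε * eta0 p (-1) * sqrtPStar p ^ ((n : ℤ) + s - 2)))) ∧
        (Odd (n + s) →
          (g β = 0 →
            ((Finset.univ.filter fun x : F => (f x ≠ 0 ∧ IsSquare (f x)) ∧ Algebra.trace (ZMod p) F (β * x) = 0).card : ℂ)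
              = (((p : ℂ) - 1) / 2) * ((p : ℂ) ^ ((n : ℤ) - 2) + ε * sqrtPStar p ^ ((n : ℤ) + s - 1)) ∧
            ((Finset.univ.filter fun x : F => (f x ≠ 0 ∧ ¬ IsSquare (f x)) ∧ Algebra.trace (ZMod p) F (β * x) = 0).card : ℂ)
              = (((p : ℂ) - 1) / 2) * ((p : ℂ) ^ ((n : ℤ) - 2) - ε * sqrtPStar p ^ ((n : ℤ) + s - 1))) ∧
          (g β ≠ 0 ∧ IsSquare (g β) →
            ((Finset.univ.filter fun x : F => (f x ≠ 0 ∧ IsSquare (f x)) ∧ Algebra.trace (ZMod p) F (β * x) = 0).card : ℂ)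
              = (((p : ℂ) - 1) / 2) * ((p : ℂ) ^ ((n : ℤ) - 2) - ε * sqrtPStar p ^ ((n : ℤ) + s - 3)) ∧
            ((Finset.univ.filter fun x : F => (f x ≠ 0 ∧ ¬ IsSquare (f x)) ∧ Algebra.trace (ZMod p) F (β * x) = 0).card : ℂ)
              = (((p : ℂ) - 1) / 2) * ((p : ℂ) ^ ((n : ℤ) - 2) - ε * sqrtPStar p ^ ((n : ℤ) + s - 3))) ∧
          (g β ≠ 0 ∧ ¬ IsSquare (g β) →
            ((Finset.univ.filter fun x : F => (f x ≠ 0 ∧ IsSquare (f x)) ∧ Algebra.trace (ZMod p) F (β * x) = 0).card : ℂ)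
              = (((p : ℂ) - 1) / 2) * ((p : ℂ) ^ ((n : ℤ) - 2) + ε * sqrtPStar p ^ ((n : ℤ) + s - 3)) ∧
            ((Finset.univ.filter fun x : F => (f x ≠ 0 ∧ ¬ IsSquare (f x)) ∧ Algebra.trace (ZMod p) F (β * x) = 0).card : ℂ)
              = (((p : ℂ) - 1) / 2) * ((p : ℂ) ^ ((n : ℤ) - 2) + ε * sqrtPStar p ^ ((n : ℤ) + s - 3))))) := by
  obtain ⟨⟨hε, hsupp, -⟩, hW0, hf0, h, hh, heven, hcop, hhom⟩ := hf
  obtain ⟨ε, rfl, hε'⟩ : ∃ k : ℤ, (k : ℂ) = ε ∧ (k = 1 ∨ k = -1) := by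
    rcases hε with rfl | rfl
    exacts [⟨1, by simp⟩, ⟨-1, by simp⟩]
  have hsymm (x : F) : f (-x) = f x := by
    simpa [heven.neg_one_pow] using hhom (-1) x
  have hW := hsupp 0 hW0
  have hg0 : g 0 = 0 := exponent_eq_zero_of_even_function hp hf0 hsymm hε'
    (by simpa [walsh] using hW)
  rw [hg0, ep_zero, mul_one] at hW
  have hP : (p : ℂ) ≠ 0 := Nat.cast_ne_zero.mpr (Fact.out : p.Prime).ne_zero
  have he := eta0_mul_self (p := p) (neg_ne_zero.mpr one_ne_zero)
  obtain ⟨z4, z3, z2, z1⟩ :=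
    zpow_sub_of_sq_eq (sqrtPStar_ne_zero hp) (sqrtPStar_sq p hp) he n s
  have hsub (Y : ℂ) : (p : ℂ) ^ ((n : ℤ) - 2) - Y = (p : ℂ) ^ ((n : ℤ) - 2) + -Y :=
    sub_eq_add_neg _ Y
  intro β hβ0
  refine ⟨fun hβ => ⟨fun hm => ?_, fun hm => ?_⟩, fun hβ => ⟨fun hm => ?_, fun hm => ?_⟩⟩
  · obtain ⟨h₁, h₂⟩ := two_mul_card_of_even (ε' := 0) (b := 0) hp hh heven hcop hq hhom hW hβ0
      (by simpa using hβ) hm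
    simp only [hsub]
    refine ⟨eq_half_mul_of_two_mul hP (h₁.trans ?_) rfl,
      eq_half_mul_of_two_mul hP (h₂.trans ?_) rfl⟩ <;> push_cast
    · linear_combination ((p : ℂ) - 1) * ε * z4
    · linear_combination ((p : ℂ) - 1) * ε * z4
  · obtain ⟨h₁, h₂⟩ := two_mul_card_of_odd (ε' := 0) (b := 0) hp hh heven hcop hq hhom hW hβ0
      (by simpa using hβ) hm
    simp only [hsub]
    refine ⟨eq_half_mul_of_two_mul hP (h₁.trans ?_) rfl,
      eq_half_mul_of_two_mul hP (h₂.trans ?_) rfl⟩ <;> push_cast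
    · linear_combination -((p : ℂ) - 1) * ε * eta0 p (-1) * z3
    · linear_combination ((p : ℂ) - 1) * ε * eta0 p (-1) * z3
  · obtain ⟨h₁, h₂⟩ := two_mul_card_of_even hp hh heven hcop hq hhom hW hβ0 (hsupp β hβ) hm
    simp only [hsub]
    refine ⟨fun hb => eq_half_mul_of_two_mul hP (h₁.trans ?_) rfl,
      fun hb => eq_half_mul_of_two_mul hP (h₁.trans ?_) rfl,
      fun hb => eq_half_mul_of_two_mul hP (h₂.trans ?_) rfl,
      fun hb => eq_half_mul_of_two_mul hP (h₂.trans ?_) rfl⟩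
    · rcases hb with hb | hb
      · rw [hb, if_pos rfl, eta0_zero]
        linear_combination ((p : ℂ) - 1) * ε * (eta0 p (-1) * z2 + sqrtPStar p ^ (n + s) * p * he)
      · rw [if_neg hb.1, eta0_of_not_isSquare hb]
        linear_combination ((p : ℂ) - 1) * ε * (eta0 p (-1) * z2 + sqrtPStar p ^ (n + s) * p * he)
    · rw [if_neg hb.1, eta0_of_isSquare hb]
      linear_combination -((p : ℂ) - 1) * ε * (eta0 p (-1) * z2 + sqrtPStar p ^ (n + s) * p * he)
    · rcases hb with hb | hb
      · rw [hb, if_pos rfl, eta0_zero]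
        linear_combination ((p : ℂ) - 1) * ε * (eta0 p (-1) * z2 + sqrtPStar p ^ (n + s) * p * he)
      · rw [if_neg hb.1, eta0_of_isSquare hb]
        linear_combination ((p : ℂ) - 1) * ε * (eta0 p (-1) * z2 + sqrtPStar p ^ (n + s) * p * he)
    · rw [if_neg hb.1, eta0_of_not_isSquare hb]
      linear_combination -((p : ℂ) - 1) * ε * (eta0 p (-1) * z2 + sqrtPStar p ^ (n + s) * p * he)
  · obtain ⟨h₁, h₂⟩ := two_mul_card_of_odd hp hh heven hcop hq hhom hW hβ0 (hsupp β hβ) hm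
    simp only [hsub]
    refine ⟨fun hb => ⟨eq_half_mul_of_two_mul hP (h₁.trans ?_) rfl,
        eq_half_mul_of_two_mul hP (h₂.trans ?_) rfl⟩,
      fun hb => ⟨eq_half_mul_of_two_mul hP (h₁.trans ?_) rfl,
        eq_half_mul_of_two_mul hP (h₂.trans ?_) rfl⟩,
      fun hb => ⟨eq_half_mul_of_two_mul hP (h₁.trans ?_) rfl,
        eq_half_mul_of_two_mul hP (h₂.trans ?_) rfl⟩⟩
    · rw [hb, if_pos rfl, eta0_zero]
      linear_combination -((p : ℂ) - 1) * ε * z1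
    · rw [hb, if_pos rfl, eta0_zero]
      linear_combination ((p : ℂ) - 1) * ε * z1
    · rw [if_neg hb.1, eta0_of_isSquare hb]
      linear_combination ((p : ℂ) - 1) * ε * z3
    · rw [if_neg hb.1, eta0_of_isSquare hb]
      linear_combination ((p : ℂ) - 1) * ε * z3
    · rw [if_neg hb.1, eta0_of_not_isSquare hb]
      linear_combination -((p : ℂ) - 1) * ε * z3
    · rw [if_neg hb.1, eta0_of_not_isSquare hb]
      linear_combination -((p : ℂ) - 1) * ε * z3
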